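/- Let C ⊆ ℝ^d be a closed convex cone upward to the direction of a nonzero vector b, and let Δ be a C°-ideal with Δ ⊆ C° and Δ containing a nonzero element, with height function φ_Δ on H = {x : ⟨x,b⟩ = 0}. Then the following are equivalent: (1) Δ = C°; (2) φ_Δ = φ_{C°}; (3) φ_Δ ≤ φ_{C°} pointwise; (4) φ_Δ(0) ≤ 0; (5) φ_Δ(0) = 0; (6) the Lebesgue measure of C° \ Δ is zero. -/

import Mathlib

open RealInnerProductSpace

/-- `C` is a convex cone: `α₁·C + α₂·C ⊆ C` for all `α₁, α₂ ≥ 0`. -/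
def IsConvCone {d : ℕ} (C : Set (EuclideanSpace ℝ (Fin d))) : Prop :=
  ∀ a b : ℝ, 0 ≤ a → 0 ≤ b → ∀ x ∈ C, ∀ y ∈ C, a • x + b • y ∈ C

/-- `C` is upward to the direction of `b`: there are `0 < c₁ < c₂ < ‖b‖` with
`{x : ⟨x,b⟩ ≥ c₂‖x‖} ⊆ C ⊆ {x : ⟨x,b⟩ ≥ c₁‖x‖}`. -/
def IsUpward {d : ℕ} (C : Set (EuclideanSpace ℝ (Fin d)))
    (b : EuclideanSpace ℝ (Fin d)) : Prop :=
  ∃ c₁ c₂ : ℝ, 0 < c₁ ∧ c₁ < c₂ ∧ c₂ < ‖b‖ ∧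
    {x | c₂ * ‖x‖ ≤ ⟪x, b⟫} ⊆ C ∧ C ⊆ {x | c₁ * ‖x‖ ≤ ⟪x, b⟫}

/-- `Δ` is a `C°`-ideal: `C° + Δ ⊆ Δ`. -/
def IsIntIdeal {d : ℕ} (C Δ : Set (EuclideanSpace ℝ (Fin d))) : Prop :=
  Δ ⊆ C ∧ ∀ u ∈ interior C, ∀ v ∈ Δ, u + v ∈ Δ

/-- `φ` is the height function of `Δ` (relative to the direction `b`):
for each `x` in the hyperplane `H = {x : ⟨x,b⟩ = 0}`, `φ x ≥ 0`,
`x + t·b ∈ Δ` for `t > φ x`, and `x + t·b ∉ Δ` for `t < φ x`. -/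
def IsHeightFun {d : ℕ} (Δ : Set (EuclideanSpace ℝ (Fin d)))
    (b : EuclideanSpace ℝ (Fin d)) (φ : EuclideanSpace ℝ (Fin d) → ℝ) : Prop :=
  ∀ x : EuclideanSpace ℝ (Fin d), ⟪x, b⟫ = 0 →
    0 ≤ φ x ∧ (∀ t : ℝ, φ x < t → x + t • b ∈ Δ) ∧ (∀ t : ℝ, t < φ x → x + t • b ∉ Δ)

/-- Positive multiples of `b` are interior points of a set that is upward to the direction of
`b`. -/
theorem IsUpward.smul_mem_interior {d : ℕ} {C : Set (EuclideanSpace ℝ (Fin d))}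
    {b : EuclideanSpace ℝ (Fin d)} (hup : IsUpward C b) (hb : b ≠ 0) {t : ℝ} (ht : 0 < t) :
    t • b ∈ interior C := by
  obtain ⟨c₁, c₂, -, -, hc₂, hsub, -⟩ := hup
  have hopen : IsOpen {x : EuclideanSpace ℝ (Fin d) | c₂ * ‖x‖ < ⟪x, b⟫} :=
    isOpen_lt (by fun_prop) (by fun_prop)
  refine hopen.subset_interior_iff.mpr
    (subset_trans (Set.ofPred_subset_ofPred.mpr fun _ => le_of_lt) hsub) ?_
  have hpos : 0 < ‖b‖ := norm_pos_iff.mpr hb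
  simp only [Set.mem_ofPred_eq, norm_smul, Real.norm_eq_abs, abs_of_pos ht, real_inner_smul_left,
    real_inner_self_eq_norm_sq]
  nlinarith [mul_pos (mul_pos ht hpos) (sub_pos.mpr hc₂)]

/-- An open set containing `c` contains `c - t • b` for some `t > 0`. -/
theorem IsOpen.exists_pos_sub_smul_mem {E : Type*} [AddCommGroup E] [Module ℝ E]
    [TopologicalSpace E] [IsTopologicalAddGroup E] [ContinuousSMul ℝ E] {U : Set E}
    (hU : IsOpen U) {c : E} (hc : c ∈ U) (b : E) : ∃ t : ℝ, 0 < t ∧ c - t • b ∈ U := by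
  have hcont : Continuous fun t : ℝ => c - t • b := by fun_prop
  have hmem : ∀ᶠ t in nhds (0 : ℝ), c - t • b ∈ U :=
    hcont.continuousAt.eventually_mem (hU.mem_nhds (by simpa using hc))
  have hpos : ∀ᶠ t in nhdsWithin (0 : ℝ) (Set.Ioi 0), 0 < t := self_mem_nhdsWithin
  exact (hpos.and (hmem.filter_mono nhdsWithin_le_nhds)).exists

/-- A larger set has a smaller height function. -/
theorem IsHeightFun.le_of_subset {d : ℕ} {Δ Δ' : Set (EuclideanSpace ℝ (Fin d))}
    {b : EuclideanSpace ℝ (Fin d)} {φ φ' : EuclideanSpace ℝ (Fin d) → ℝ}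
    (hφ : IsHeightFun Δ b φ) (hφ' : IsHeightFun Δ' b φ') (hsub : Δ ⊆ Δ')
    {x : EuclideanSpace ℝ (Fin d)} (hx : ⟪x, b⟫ = 0) : φ' x ≤ φ x := by
  by_contra! h
  obtain ⟨t, ht, ht'⟩ := exists_between h
  exact (hφ' x hx).2.2 t ht' (hsub ((hφ x hx).2.1 t ht))

open MeasureTheory in
theorem stmt19 {d : ℕ} (C : Set (EuclideanSpace ℝ (Fin d)))
    (hcone : IsConvCone C) (hclosed : IsClosed C)
    (b : EuclideanSpace ℝ (Fin d)) (hb : b ≠ 0) (hup : IsUpward C b)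
    (Δ : Set (EuclideanSpace ℝ (Fin d)))
    (hΔint : Δ ⊆ interior C)
    (hΔ : ∀ u ∈ interior C, ∀ v ∈ Δ, u + v ∈ Δ)
    (hne : ∃ z ∈ Δ, z ≠ 0)
    (φΔ φI : EuclideanSpace ℝ (Fin d) → ℝ)
    (hφΔ : IsHeightFun Δ b φΔ) (hφI : IsHeightFun (interior C) b φI) :
    -- (1) ↔ (2)
    ((Δ = interior C) ↔
      (∀ x : EuclideanSpace ℝ (Fin d), ⟪x, b⟫ = 0 → φΔ x = φI x)) ∧
    -- (1) ↔ (3)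
    ((Δ = interior C) ↔
      (∀ x : EuclideanSpace ℝ (Fin d), ⟪x, b⟫ = 0 → φΔ x ≤ φI x)) ∧
    -- (1) ↔ (4)
    ((Δ = interior C) ↔ φΔ 0 ≤ 0) ∧
    -- (1) ↔ (5)
    ((Δ = interior C) ↔ φΔ 0 = 0) ∧
    -- (1) ↔ (6)
    ((Δ = interior C) ↔ volume (interior C \ Δ) = 0) := by
  have hopen : IsOpen (interior C) := isOpen_interior
  have h0 : ⟪(0 : EuclideanSpace ℝ (Fin d)), b⟫ = 0 := inner_zero_left b
  have hI0 : φI 0 ≤ 0 := by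
    by_contra! h
    obtain ⟨t, ht, ht'⟩ := exists_between h
    exact (hφI 0 h0).2.2 t ht' (by simpa using hup.smul_mem_interior hb ht)
  have height_eq (h : Δ = interior C) (x : EuclideanSpace ℝ (Fin d)) (hx : ⟪x, b⟫ = 0) :
      φΔ x = φI x :=
    le_antisymm (hφI.le_of_subset hφΔ h.ge hx) (hφΔ.le_of_subset hφI h.le hx)
  have eq_interior (h : φΔ 0 ≤ 0) : Δ = interior C := by
    refine hΔint.antisymm fun c hc => ?_
    obtain ⟨t, ht, htc⟩ := hopen.exists_pos_sub_smul_mem hc b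
    simpa using hΔ _ htc _ ((hφΔ 0 h0).2.1 t (h.trans_lt ht))
  refine ⟨⟨height_eq, fun h => eq_interior ((h 0 h0).trans_le hI0)⟩,
    ⟨fun h x hx => (height_eq h x hx).le, fun h => eq_interior ((h 0 h0).trans hI0)⟩,
    ⟨fun h => (height_eq h 0 h0).trans_le hI0, eq_interior⟩,
    ⟨fun h => ((height_eq h 0 h0).trans_le hI0).antisymm (hφΔ 0 h0).1,
      fun h => eq_interior h.le⟩,
    ⟨fun h => by simp [h], fun h => hΔint.antisymm fun c hc => ?_⟩⟩
  by_contra hcΔ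
  obtain ⟨t, ht, htc⟩ := hopen.exists_pos_sub_smul_mem hc b
  have hU : IsOpen (interior C ∩ (fun v => c - v) ⁻¹' interior C) :=
    hopen.inter (hopen.preimage (by fun_prop))
  have hUsub : interior C ∩ (fun v => c - v) ⁻¹' interior C ⊆ interior C \ Δ := fun v hv =>
    ⟨hv.1, fun hvΔ => hcΔ (by simpa using hΔ _ hv.2 _ hvΔ)⟩
  exact (hU.measure_pos volume ⟨t • b, hup.smul_mem_interior hb ht, htc⟩).ne'
    (measure_mono_null hUsub h)
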